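/- Let (X, 𝓕, μ) be a σ-finite measure space, Φ an N-function satisfying the Δ₂-condition globally, and φ : X → X a nonsingular measurable map with μ(φ⁻¹(F)) ≤ c μ(F) for every F ∈ 𝓕 and some c > 0. Suppose there exist a nonempty countable family {F_i}_{i∈I} of measurable sets with 0 < μ(F_i) < ∞ for all i ∈ I and a strictly increasing sequence (β_j)_{j∈ℕ} of positive integers such that: (I) for every i ∈ I, lim_{j→∞} Φ⁻¹(1/μ(φ^{-β_j}(F_i))) = ∞, and (II) sup{ Φ⁻¹(1/μ(F_i)) / Φ⁻¹(1/μ(φ^{-n}(F_i))) : i ∈ I, n ∈ ℕ } = ∞. Then C_φ has an irregular vector: there exists f ∈ L^Φ(μ) with liminf_{n→∞} N_Φ(f ∘ φ^n) = 0 and limsup_{n→∞} N_Φ(f ∘ φ^n) = ∞. -/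

import Mathlib

open MeasureTheory Filter Topology Set
open scoped ENNReal NNReal

noncomputable section

/-- A Young function: an even convex function `Φ : ℝ → [0,∞]` with `Φ 0 = 0` and
`Φ x → ∞` as `x → ∞`. -/
structure IsYoungFunction (Φ : ℝ → ℝ≥0∞) : Prop where
  even : ∀ x : ℝ, Φ (-x) = Φ x
  convex : ∀ x y : ℝ, ∀ a b : ℝ≥0, a + b = 1 →
    Φ ((a : ℝ) * x + (b : ℝ) * y) ≤ (a : ℝ≥0∞) * Φ x + (b : ℝ≥0∞) * Φ y
  map_zero : Φ 0 = 0
  tendsto_atTop : Tendsto Φ atTop (nhds ⊤)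

/-- An N-function: a finite-valued Young function vanishing exactly at `0`, with
`Φ x / x → 0` as `x → 0⁺` and `Φ x / x → ∞` as `x → ∞`. -/
structure IsNFunction (Φ : ℝ → ℝ≥0∞) extends IsYoungFunction Φ : Prop where
  lt_top : ∀ x : ℝ, Φ x < ⊤
  eq_zero_iff : ∀ x : ℝ, Φ x = 0 ↔ x = 0
  tendsto_div_zero : Tendsto (fun x : ℝ => Φ x / ENNReal.ofReal x) (nhdsWithin 0 (Set.Ioi 0)) (nhds 0)
  tendsto_div_atTop : Tendsto (fun x : ℝ => Φ x / ENNReal.ofReal x) atTop (nhds ⊤)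

/-- The Δ₂-condition, globally: `Φ (2 x) ≤ K Φ x` for all `x ≥ 0`, for some `K > 0`. -/
def Delta2Global (Φ : ℝ → ℝ≥0∞) : Prop :=
  ∃ K : ℝ≥0, 0 < K ∧ ∀ x : ℝ, 0 ≤ x → Φ (2 * x) ≤ (K : ℝ≥0∞) * Φ x

/-- The generalized inverse `Φ⁻¹ (y) = inf {x ≥ 0 : Φ x > y}` (with `inf ∅ = ∞`). -/
def youngInv (Φ : ℝ → ℝ≥0∞) (y : ℝ≥0∞) : ℝ≥0∞ :=
  ⨅ (x : ℝ) (_ : 0 ≤ x) (_ : y < Φ x), ENNReal.ofReal x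

/-- The Luxemburg (gauge) norm `N_Φ (f) = inf {k > 0 : ∫ Φ (f / k) dμ ≤ 1}`
(with `inf ∅ = ∞`). -/
def luxNorm {X : Type*} [MeasurableSpace X] (Φ : ℝ → ℝ≥0∞) (μ : Measure X)
    (f : X → ℝ) : ℝ≥0∞ :=
  ⨅ (k : ℝ) (_ : 0 < k) (_ : ∫⁻ x, Φ (f x / k) ∂μ ≤ 1), ENNReal.ofReal k

/-- Membership in the Orlicz space `L^Φ(μ)`: `f` is measurable and
`∫ Φ (k f) dμ < ∞` for some `k > 0`. -/
def MemOrlicz {X : Type*} [MeasurableSpace X] (Φ : ℝ → ℝ≥0∞) (μ : Measure X)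
    (f : X → ℝ) : Prop :=
  Measurable f ∧ ∃ k : ℝ, 0 < k ∧ ∫⁻ x, Φ (k * f x) ∂μ < ⊤

/-- Li-Yorke chaos for the composition operator `C_φ f = f ∘ φ` on `L^Φ(μ)`:
there is an uncountable set `S ⊆ L^Φ(μ)` of pairwise not μ-a.e. equal functions such
that every pair of not μ-a.e. equal members is a Li-Yorke pair for `C_φ`. -/
def CompLiYorkeChaotic {X : Type*} [MeasurableSpace X] (Φ : ℝ → ℝ≥0∞) (μ : Measure X)
    (φ : X → X) : Prop :=
  ∃ S : Set (X → ℝ), ¬ S.Countable ∧ (∀ f ∈ S, MemOrlicz Φ μ f) ∧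
    (∀ f ∈ S, ∀ g ∈ S, f ≠ g → ¬ f =ᵐ[μ] g) ∧
    ∀ f ∈ S, ∀ g ∈ S, ¬ f =ᵐ[μ] g →
      atTop.liminf (fun n : ℕ => luxNorm Φ μ ((f - g) ∘ φ^[n])) = 0 ∧
      0 < atTop.limsup (fun n : ℕ => luxNorm Φ μ ((f - g) ∘ φ^[n]))

/-- The abstract gliding hump: a bounded-growth family of nonnegative sequences, each small along
a common subsequence and unbounded altogether, has a summable positive combination oscillating
between `0` and `∞`. -/
lemma exists_weights_oscillating (r : ℕ → ℕ → ℝ≥0) (C : ℝ≥0) (β : ℕ → ℕ) (hβ : StrictMono β)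
    (hC : ∀ i n, r i n ≤ C ^ n)
    (h0 : ∀ i, Tendsto (fun j => r i (β j)) atTop (𝓝 0))
    (hsup : ∀ M : ℝ≥0, ∃ i n, M ≤ r i n) :
    ∃ (ι : ℕ → ℕ) (ε : ℕ → ℝ≥0),
      (∀ n, ∑' l, ((ε l * r (ι l) n : ℝ≥0) : ℝ≥0∞) < ⊤) ∧
      (∀ δ : ℝ≥0∞, 0 < δ → ∃ᶠ n in atTop, ∑' l, ((ε l * r (ι l) n : ℝ≥0) : ℝ≥0∞) < δ) ∧
      (∀ M : ℝ≥0∞, M < ⊤ → ∃ᶠ n in atTop, M < ∑' l, ((ε l * r (ι l) n : ℝ≥0) : ℝ≥0∞)) := by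
  have hsup' : ∀ (M : ℝ≥0) (N : ℕ), ∃ i n, N ≤ n ∧ M ≤ r i n := by
    intro M N
    obtain ⟨i, n, h⟩ := hsup (M + ∑ k ∈ Finset.range N, C ^ k + 1)
    refine ⟨i, n, ?_, le_trans (by rw [add_assoc]; exact le_self_add) h⟩
    by_contra! hn
    have h1 : C ^ n ≤ ∑ k ∈ Finset.range N, C ^ k :=
      Finset.single_le_sum (f := fun k => C ^ k) (fun _ _ => zero_le) (Finset.mem_range.2 hn)
    have h2 := (h.trans (hC i n)).trans h1
    have h3 : ∑ k ∈ Finset.range N, C ^ k < M + ∑ k ∈ Finset.range N, C ^ k + 1 :=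
      lt_of_le_of_lt le_add_self (lt_add_one _)
    exact absurd h2 (not_le.2 h3)
  -- a tuple is `(k, i, n, p, ε)`: generation, index, time of the peak, time of the dip, weight
  let A : ℕ × ℕ × ℕ × ℕ × ℝ≥0 → ℕ × ℕ × ℕ × ℕ × ℝ≥0 → Prop := fun x y =>
    x.2.2.2.2 * r x.2.1 y.2.2.2.1 ≤ (1 / 2) ^ (x.1 + y.1)
  let P : ℕ × ℕ × ℕ × ℕ × ℝ≥0 → Prop := fun y =>
    A y y ∧ (y.1 : ℝ≥0) ≤ y.2.2.2.2 * r y.2.1 y.2.2.1 ∧ y.2.2.2.2 ≤ (1 / 2) ^ y.1 ∧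
      y.1 ≤ y.2.2.1 ∧ y.1 ≤ y.2.2.2.1
  obtain ⟨s, hP, hs⟩ := exists_seq_of_forall_finset_exists P
    (fun x y => x.1 < y.1 ∧ A x y ∧ A y x) (by
      intro t _
      let k := t.sup (fun x => x.1) + 1
      have hhalf : ∀ a : ℕ, (0 : ℝ≥0) < (1 / 2) ^ a := fun a => by positivity
      have hε : ∀ᶠ ε : ℝ≥0 in 𝓝[>] 0,
          (∀ x ∈ t, ε * C ^ x.2.2.2.1 ≤ (1 / 2) ^ (k + x.1)) ∧ ε ≤ (1 / 2) ^ k ∧ 0 < ε := by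
        refine ((Filter.eventually_all_finset t).2 fun x _ => ?_).and
          (Filter.Eventually.and ?_ self_mem_nhdsWithin)
        · have : Tendsto (fun ε : ℝ≥0 => ε * C ^ x.2.2.2.1) (𝓝[>] 0) (𝓝 0) := by
            have h : Continuous (fun ε : ℝ≥0 => ε * C ^ x.2.2.2.1) := by fun_prop
            simpa using (h.tendsto 0).mono_left nhdsWithin_le_nhds
          exact this.eventually_le_const (hhalf _)
        · exact (tendsto_id.mono_left nhdsWithin_le_nhds).eventually_le_const (hhalf _)
      obtain ⟨ε, hε1, hε2, hε0⟩ := hε.exists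
      obtain ⟨i, n, hkn, hn⟩ := hsup' (k / ε) k
      have hdip : ∀ (a : ℝ≥0) (i b : ℕ), ∀ᶠ j in atTop, a * r i (β j) ≤ (1 / 2) ^ b := by
        intro a i b
        have : Tendsto (fun j => a * r i (β j)) atTop (𝓝 0) := by
          simpa using (h0 i).const_mul a
        exact this.eventually_le_const (hhalf _)
      have hj : ∀ᶠ j in atTop,
          (∀ x ∈ t, x.2.2.2.2 * r x.2.1 (β j) ≤ (1 / 2) ^ (x.1 + k)) ∧
          ε * r i (β j) ≤ (1 / 2) ^ (k + k) ∧ k ≤ β j :=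
        ((Filter.eventually_all_finset t).2 fun x _ => hdip _ _ _).and
          ((hdip _ _ _).and (hβ.tendsto_atTop.eventually_ge_atTop k))
      obtain ⟨j, hj1, hj2, hj3⟩ := hj.exists
      refine ⟨(k, i, n, β j, ε), ⟨hj2, ?_, hε2, hkn, hj3⟩, fun x hx => ⟨?_, hj1 x hx, ?_⟩⟩
      · rw [div_le_iff₀ hε0, mul_comm] at hn
        exact hn
      · exact Nat.lt_succ_of_le (Finset.le_sup (f := fun x : ℕ × ℕ × ℕ × ℕ × ℝ≥0 => x.1) hx)
      · exact le_trans (mul_le_mul_right (hC _ _) _) (hε1 x hx))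
  have hmono : StrictMono (fun l => (s l).1) := fun a b h => (hs a b h).1
  have hA : ∀ l k, A (s l) (s k) := by
    intro l k
    rcases lt_trichotomy l k with h | h | h
    · exact (hs _ _ h).2.1
    · exact h ▸ (hP l).1
    · exact (hs _ _ h).2.2
  have hpow : ∀ l, ((1 / 2 : ℝ≥0)) ^ (s l).1 ≤ (1 / 2) ^ l := fun l =>
    pow_le_pow_of_le_one zero_le (by norm_num) (hmono.le_apply)
  have hgeom : ∑' l : ℕ, (((1 / 2 : ℝ≥0) ^ l : ℝ≥0) : ℝ≥0∞) = 2 := by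
    simp only [ENNReal.coe_pow]
    rw [ENNReal.tsum_geometric]
    simp
  have hcomb : ∀ (n : ℕ) (D : ℝ≥0),
      (∀ l, (s l).2.2.2.2 * r (s l).2.1 n ≤ (1 / 2) ^ l * D) →
      ∑' l, (((s l).2.2.2.2 * r (s l).2.1 n : ℝ≥0) : ℝ≥0∞) ≤ 2 * D := by
    intro n D h
    calc _ ≤ ∑' l : ℕ, (((1 / 2 : ℝ≥0) ^ l : ℝ≥0) : ℝ≥0∞) * D :=
          ENNReal.tsum_le_tsum fun l => by exact_mod_cast h l
      _ = 2 * D := by rw [ENNReal.tsum_mul_right, hgeom]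
  refine ⟨fun l => (s l).2.1, fun l => (s l).2.2.2.2, fun n => ?_, fun δ hδ => ?_, fun M hM => ?_⟩
  · refine lt_of_le_of_lt (hcomb n (C ^ n) fun l =>
      mul_le_mul' ((hP l).2.2.1.trans (hpow l)) (hC _ _)) ?_
    exact ENNReal.mul_lt_top (by simp) (by simp)
  · rw [Filter.frequently_atTop]
    intro N
    have ht : Tendsto (fun k : ℕ => (2 : ℝ≥0∞) * (((1 / 2 : ℝ≥0) ^ k : ℝ≥0) : ℝ≥0∞))
        atTop (𝓝 0) := by
      have h := ENNReal.Tendsto.const_mul (a := 2) (ENNReal.tendsto_coe.2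
        (tendsto_pow_atTop_nhds_zero_of_lt_one (r := (1 / 2 : ℝ≥0)) zero_le (by
          rw [one_div]; exact inv_lt_one_of_one_lt₀ (by norm_num))))
        (Or.inr (by simp))
      simpa using h
    obtain ⟨k, hk, hkN⟩ := ((ht.eventually_lt_const hδ).and (eventually_ge_atTop N)).exists
    refine ⟨(s k).2.2.2.1, hkN.trans (hmono.le_apply.trans (hP k).2.2.2.2), ?_⟩
    refine lt_of_le_of_lt (hcomb _ ((1 / 2) ^ k) fun l => ?_) hk
    refine (hA l k).trans ?_
    rw [pow_add]
    exact mul_le_mul' (hpow l) (hpow k)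
  · rw [Filter.frequently_atTop]
    intro N
    obtain ⟨a, ha⟩ := exists_nat_gt M.toNNReal
    let k := max a N
    refine ⟨(s k).2.2.1, (le_max_right a N).trans (hmono.le_apply.trans (hP k).2.2.2.1), ?_⟩
    refine lt_of_lt_of_le ?_ (ENNReal.le_tsum k)
    rw [← ENNReal.coe_toNNReal hM.ne]
    refine ENNReal.coe_lt_coe.2 (ha.trans_le (le_trans ?_ (hP k).2.1))
    exact_mod_cast (le_max_left a N).trans (hmono.le_apply (x := k))

lemma IsYoungFunction.map_mul_le {Φ : ℝ → ℝ≥0∞} (hΦ : IsYoungFunction Φ) (x : ℝ) {a : ℝ≥0}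
    (ha : a ≤ 1) : Φ (a * x) ≤ a * Φ x := by
  have h := hΦ.convex x 0 a (1 - a) (add_tsub_cancel_of_le ha)
  simpa [hΦ.map_zero] using h

lemma IsYoungFunction.mono_abs {Φ : ℝ → ℝ≥0∞} (hΦ : IsYoungFunction Φ) {x y : ℝ}
    (h : |x| ≤ |y|) : Φ x ≤ Φ y := by
  have habs : ∀ z, Φ |z| = Φ z := fun z => by
    rcases abs_choice z with h | h <;> rw [h]
    exact hΦ.even z
  rw [← habs x, ← habs y]
  rcases (abs_nonneg y).eq_or_lt with h0 | h0
  · rw [le_antisymm (h.trans h0.symm.le) (abs_nonneg x), ← h0]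
  · have hle : |x| / |y| ≤ 1 := (div_le_one h0).2 h
    let a : ℝ≥0 := ⟨|x| / |y|, by positivity⟩
    have ha : a ≤ 1 := by exact_mod_cast hle
    have hx : (a : ℝ) * |y| = |x| := div_mul_cancel₀ _ h0.ne'
    calc Φ |x| = Φ (a * |y|) := by rw [hx]
      _ ≤ a * Φ |y| := hΦ.map_mul_le _ ha
      _ ≤ 1 * Φ |y| := by gcongr; exact_mod_cast ha
      _ = Φ |y| := one_mul _

lemma IsYoungFunction.mul_le_map {Φ : ℝ → ℝ≥0∞} (hΦ : IsYoungFunction Φ) (x : ℝ) {M : ℝ≥0}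
    (hM : 1 ≤ M) : M * Φ x ≤ Φ (M * x) := by
  have hM0 : M ≠ 0 := (zero_lt_one.trans_le hM).ne'
  have h := hΦ.map_mul_le (M * x) (a := M⁻¹) (inv_le_one_of_one_le₀ hM)
  rw [← mul_assoc, ← NNReal.coe_mul, inv_mul_cancel₀ hM0, NNReal.coe_one, one_mul] at h
  calc (M : ℝ≥0∞) * Φ x ≤ M * (((M⁻¹ : ℝ≥0) : ℝ≥0∞) * Φ (M * x)) := by gcongr
    _ = Φ (M * x) := by
      rw [← mul_assoc, ← ENNReal.coe_mul, mul_inv_cancel₀ hM0, ENNReal.coe_one, one_mul]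

lemma IsNFunction.continuous {Φ : ℝ → ℝ≥0∞} (hΦ : IsNFunction Φ) :
    Continuous (fun x => (Φ x).toReal) := by
  have hconv : ConvexOn ℝ univ (fun x => (Φ x).toReal) := by
    refine ⟨convex_univ, fun x _ y _ a b ha hb hab => ?_⟩
    lift a to ℝ≥0 using ha
    lift b to ℝ≥0 using hb
    have h := hΦ.convex x y a b (by exact_mod_cast hab)
    have hx := (hΦ.lt_top x).ne
    have hy := (hΦ.lt_top y).ne
    have h' := ENNReal.toReal_mono (by finiteness) h
    rw [ENNReal.toReal_add (by finiteness) (by finiteness)] at h'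
    simpa using h'
  exact continuousOn_univ.1 (hconv.continuousOn isOpen_univ)

/-- A measurable right inverse of an N-function. -/
lemma IsNFunction.exists_measurable_rightInverse {Φ : ℝ → ℝ≥0∞} (hΦ : IsNFunction Φ) :
    ∃ ψ : ℝ≥0∞ → ℝ, Measurable ψ ∧ ∀ y, y < ⊤ → Φ (ψ y) = y := by
  have hsurj : ∀ y : ℝ≥0, ∃ x : ℝ, 0 ≤ x ∧ Φ x = y := by
    intro y
    obtain ⟨b, hb0, hb⟩ := ((eventually_ge_atTop (0 : ℝ)).and
      (hΦ.tendsto_atTop.eventually_const_le (u := (y : ℝ≥0∞)) (by simp))).exists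
    have hmem : (y : ℝ) ∈ Icc (Φ 0).toReal (Φ b).toReal := by
      refine ⟨by simp [hΦ.map_zero], ?_⟩
      simpa using ENNReal.toReal_mono (hΦ.lt_top b).ne hb
    obtain ⟨x, hx, hxy⟩ := intermediate_value_Icc hb0 hΦ.continuous.continuousOn hmem
    refine ⟨x, hx.1, ?_⟩
    rw [← ENNReal.ofReal_toReal (hΦ.lt_top x).ne]
    simp only at hxy
    rw [hxy, ENNReal.ofReal_coe_nnreal]
  choose g hg0 hg using hsurj
  refine ⟨fun y => g y.toNNReal, ?_, fun y hy => ?_⟩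
  · have hmono : Monotone g := by
      intro y z hyz
      by_contra! h
      have h1 : Φ (g z) ≤ Φ (g y) := hΦ.mono_abs (by
        rw [abs_of_nonneg (hg0 z), abs_of_nonneg (hg0 y)]; exact h.le)
      rw [hg, hg, ENNReal.coe_le_coe] at h1
      rw [le_antisymm hyz h1] at h
      exact lt_irrefl _ h
    exact hmono.measurable.comp ENNReal.measurable_toNNReal
  · simp only [hg, ENNReal.coe_toNNReal hy.ne]

lemma IsYoungFunction.map_two_pow_mul_le {Φ : ℝ → ℝ≥0∞} (hΦ : IsYoungFunction Φ) {K : ℝ≥0}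
    (hK : ∀ x : ℝ, 0 ≤ x → Φ (2 * x) ≤ (K : ℝ≥0∞) * Φ x) (j : ℕ) (x : ℝ) :
    Φ (2 ^ j * x) ≤ (K : ℝ≥0∞) ^ j * Φ x := by
  induction j with
  | zero => simp
  | succ j ih =>
    calc Φ (2 ^ (j + 1) * x) ≤ Φ (2 * |2 ^ j * x|) := by
          apply hΦ.mono_abs
          rw [pow_succ', mul_assoc, abs_mul, abs_mul (2 : ℝ) |2 ^ j * x|, abs_abs]
      _ ≤ K * Φ |2 ^ j * x| := hK _ (abs_nonneg _)
      _ ≤ K * Φ (2 ^ j * x) := by gcongr; exact hΦ.mono_abs (abs_abs _).le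
      _ ≤ K * ((K : ℝ≥0∞) ^ j * Φ x) := by gcongr
      _ = (K : ℝ≥0∞) ^ (j + 1) * Φ x := by rw [pow_succ', mul_assoc]

lemma luxNorm_le_of_lintegral_le {X : Type*} [MeasurableSpace X] {μ : Measure X}
    {Φ : ℝ → ℝ≥0∞} (hΦ : IsYoungFunction Φ) {K : ℝ≥0}
    (hK : ∀ x : ℝ, 0 ≤ x → Φ (2 * x) ≤ (K : ℝ≥0∞) * Φ x) (j : ℕ) {g : X → ℝ}
    (hg : (K : ℝ≥0∞) ^ j * ∫⁻ x, Φ (g x) ∂μ ≤ 1) :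
    luxNorm Φ μ g ≤ ENNReal.ofReal ((2 ^ j)⁻¹) := by
  refine iInf_le_of_le ((2 ^ j)⁻¹) (iInf_le_of_le (by positivity) (iInf_le_of_le ?_ le_rfl))
  calc ∫⁻ x, Φ (g x / (2 ^ j)⁻¹) ∂μ ≤ ∫⁻ x, (K : ℝ≥0∞) ^ j * Φ (g x) ∂μ := by
        refine lintegral_mono fun x => ?_
        rw [div_inv_eq_mul, mul_comm]
        exact hΦ.map_two_pow_mul_le hK j _
    _ = (K : ℝ≥0∞) ^ j * ∫⁻ x, Φ (g x) ∂μ := lintegral_const_mul' _ _ (by finiteness)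
    _ ≤ 1 := hg

lemma le_luxNorm_of_lt_lintegral {X : Type*} [MeasurableSpace X] {μ : Measure X}
    {Φ : ℝ → ℝ≥0∞} (hΦ : IsYoungFunction Φ) {K : ℝ≥0}
    (hK : ∀ x : ℝ, 0 ≤ x → Φ (2 * x) ≤ (K : ℝ≥0∞) * Φ x) (j : ℕ) {g : X → ℝ}
    (hg : (K : ℝ≥0∞) ^ j < ∫⁻ x, Φ (g x) ∂μ) :
    ENNReal.ofReal (2 ^ j) ≤ luxNorm Φ μ g := by
  refine le_iInf fun k => le_iInf fun hk => le_iInf fun hint => ENNReal.ofReal_le_ofReal ?_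
  by_contra! hlt
  refine absurd hg (not_lt.2 ?_)
  calc ∫⁻ x, Φ (g x) ∂μ ≤ ∫⁻ x, (K : ℝ≥0∞) ^ j * Φ (g x / k) ∂μ := by
        refine lintegral_mono fun x => le_trans (hΦ.mono_abs ?_)
          (hΦ.map_two_pow_mul_le hK j (g x / k))
        calc |g x| = k * |g x / k| := by
              rw [abs_div, abs_of_pos hk, mul_div_cancel₀ _ hk.ne']
          _ ≤ 2 ^ j * |g x / k| := by gcongr
          _ = |2 ^ j * (g x / k)| := by rw [abs_mul, abs_of_pos (by positivity : (0 : ℝ) < 2 ^ j)]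
    _ = (K : ℝ≥0∞) ^ j * ∫⁻ x, Φ (g x / k) ∂μ := lintegral_const_mul' _ _ (by finiteness)
    _ ≤ (K : ℝ≥0∞) ^ j * 1 := by gcongr
    _ = (K : ℝ≥0∞) ^ j := mul_one _

lemma tendsto_zero_of_tendsto_youngInv {ι : Type*} {l : Filter ι} {Φ : ℝ → ℝ≥0∞}
    (hΦ : IsYoungFunction Φ) {m : ι → ℝ≥0∞}
    (h : Tendsto (fun j => youngInv Φ (1 / m j)) l (𝓝 ⊤)) : Tendsto m l (𝓝 0) := by
  rw [ENNReal.tendsto_nhds_zero]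
  intro δ hδ
  obtain ⟨x, hx0, hx⟩ := ((eventually_ge_atTop (0 : ℝ)).and
    (hΦ.tendsto_atTop.eventually_const_lt (u := δ⁻¹)
      (lt_top_iff_ne_top.2 (ENNReal.inv_ne_top.2 hδ.ne')))).exists
  filter_upwards [h.eventually_const_lt (u := ENNReal.ofReal x) (by simp)] with j hj
  by_contra! hlt
  refine absurd hj (not_lt.2 ?_)
  refine iInf_le_of_le x (iInf_le_of_le hx0 (iInf_le_of_le ?_ le_rfl))
  rw [one_div]
  exact lt_of_le_of_lt (ENNReal.inv_le_inv.2 hlt.le) hx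

lemma youngInv_one_div_le {Φ : ℝ → ℝ≥0∞} (hΦ : IsYoungFunction Φ) {M : ℝ≥0} (hM : 1 ≤ M)
    {a b : ℝ≥0∞} (h : b ≤ M * a) : youngInv Φ (1 / a) ≤ M * youngInv Φ (1 / b) := by
  have hM0 : M ≠ 0 := (zero_lt_one.trans_le hM).ne'
  have hM0' : (M : ℝ≥0∞) ≠ 0 := by exact_mod_cast hM0
  unfold youngInv
  simp only [ENNReal.mul_iInf_of_ne hM0' ENNReal.coe_ne_top]
  refine le_iInf fun x => le_iInf fun hx => le_iInf fun hlt => ?_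
  refine iInf_le_of_le (M * x) (iInf_le_of_le (by positivity) (iInf_le_of_le ?_ ?_))
  · refine lt_of_lt_of_le ?_ (hΦ.mul_le_map x hM)
    calc 1 / a ≤ M * (1 / b) := by
          rw [one_div, one_div]
          calc a⁻¹ = M * (M * a)⁻¹ := by
                rw [ENNReal.mul_inv (Or.inl hM0') (Or.inl ENNReal.coe_ne_top), ← mul_assoc,
                  ENNReal.mul_inv_cancel hM0' ENNReal.coe_ne_top, one_mul]
            _ ≤ M * b⁻¹ := by gcongr
      _ < M * Φ x := ENNReal.mul_lt_mul_right hM0' ENNReal.coe_ne_top hlt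
  · rw [ENNReal.ofReal_mul (by positivity), ENNReal.ofReal_coe_nnreal]

lemma measure_preimage_iterate_le {X : Type*} [MeasurableSpace X] {μ : Measure X} {φ : X → X}
    (hφ : Measurable φ) {c : ℝ≥0}
    (hbound : ∀ F : Set X, MeasurableSet F → μ (φ ⁻¹' F) ≤ (c : ℝ≥0∞) * μ F)
    {F : Set X} (hF : MeasurableSet F) (n : ℕ) :
    μ (φ^[n] ⁻¹' F) ≤ (c : ℝ≥0∞) ^ n * μ F := by
  induction n with
  | zero => simp
  | succ n ih =>
    rw [Function.iterate_succ, preimage_comp]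
    refine (hbound _ (hφ.iterate n hF)).trans ?_
    rw [pow_succ', mul_assoc]
    gcongr

/-- Sufficiency part of Theorem 2.2: if there exist a nonempty countable family `{F i}` of
measurable sets of finite positive measure and a strictly increasing sequence `β` of positive
integers satisfying conditions (I) and (II), then `C_φ` has an irregular vector in `L^Φ(μ)`. -/
theorem exists_irregular_vector_of_family
    {X : Type*} [MeasurableSpace X] (μ : Measure X) [SigmaFinite μ]
    (Φ : ℝ → ℝ≥0∞) (hΦ : IsNFunction Φ) (hΔ : Delta2Global Φ)
    (φ : X → X) (hφ : Measurable φ) (c : ℝ≥0) (hc : 0 < c)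
    (hbound : ∀ F : Set X, MeasurableSet F → μ (φ ⁻¹' F) ≤ (c : ℝ≥0∞) * μ F)
    (F : ℕ → Set X) (β : ℕ → ℕ) (hβ : StrictMono β) (hβpos : ∀ j, 0 < β j)
    (hFmeas : ∀ i, MeasurableSet (F i)) (hF0 : ∀ i, 0 < μ (F i)) (hF1 : ∀ i, μ (F i) < ⊤)
    (hI : ∀ i, Tendsto (fun j : ℕ => youngInv Φ (1 / μ (φ^[β j] ⁻¹' F i))) atTop (nhds ⊤))
    (hII : (⨆ (i : ℕ) (n : ℕ),
      youngInv Φ (1 / μ (F i)) / youngInv Φ (1 / μ (φ^[n] ⁻¹' F i))) = ⊤) :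
    ∃ f : X → ℝ, MemOrlicz Φ μ f ∧
      atTop.liminf (fun n : ℕ => luxNorm Φ μ (f ∘ φ^[n])) = 0 ∧
      atTop.limsup (fun n : ℕ => luxNorm Φ μ (f ∘ φ^[n])) = ⊤ := by
  obtain ⟨K, -, hK⟩ := hΔ
  have hY := hΦ.toIsYoungFunction
  have hm : ∀ i n, μ (φ^[n] ⁻¹' F i) ≤ (c : ℝ≥0∞) ^ n * μ (F i) := fun i n =>
    measure_preimage_iterate_le hφ hbound (hFmeas i) n
  have hfin : ∀ i n, μ (φ^[n] ⁻¹' F i) / μ (F i) ≤ ((c ^ n : ℝ≥0) : ℝ≥0∞) := fun i n => by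
    rw [ENNReal.coe_pow]
    exact ENNReal.div_le_of_le_mul (hm i n)
  have hfin' : ∀ i n, μ (φ^[n] ⁻¹' F i) / μ (F i) ≠ ⊤ := fun i n =>
    ((hfin i n).trans_lt ENNReal.coe_lt_top).ne
  obtain ⟨ι, ε, hS, hS0, hStop⟩ := exists_weights_oscillating
    (fun i n => (μ (φ^[n] ⁻¹' F i) / μ (F i)).toNNReal) c β hβ
    (fun i n => ENNReal.toNNReal_mono ENNReal.coe_ne_top (hfin i n))
    (fun i => by
      have h := ENNReal.Tendsto.mul_const (b := (μ (F i))⁻¹)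
        (tendsto_zero_of_tendsto_youngInv hY (hI i)) (Or.inr (by simp [(hF0 i).ne']))
      rw [zero_mul] at h
      exact (ENNReal.tendsto_toNNReal ENNReal.zero_ne_top).comp h)
    (fun M => by
      by_contra! hcon
      have hle : (⨆ (i : ℕ) (n : ℕ), youngInv Φ (1 / μ (F i)) /
          youngInv Φ (1 / μ (φ^[n] ⁻¹' F i))) ≤ ((M + 1 : ℝ≥0) : ℝ≥0∞) := by
        refine iSup_le fun i => iSup_le fun n => ENNReal.div_le_of_le_mul ?_
        refine youngInv_one_div_le hY le_add_self ?_
        rw [← ENNReal.div_le_iff_le_mul (Or.inl (hF0 i).ne') (Or.inl (hF1 i).ne),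
          ← ENNReal.coe_toNNReal (hfin' i n)]
        exact ENNReal.coe_le_coe.2 ((hcon i n).le.trans le_self_add)
      rw [hII] at hle
      exact absurd hle (by simp))
  obtain ⟨ψ, hψm, hψ⟩ := hΦ.exists_measurable_rightInverse
  let h : X → ℝ≥0∞ := fun x => ∑' l, (F (ι l)).indicator (fun _ => ε l / μ (F (ι l))) x
  have hh : Measurable h := Measurable.tsum fun l => measurable_const.indicator (hFmeas _)
  have hint : ∀ n, ∫⁻ x, h (φ^[n] x) ∂μ =
      ∑' l, ((ε l * (μ (φ^[n] ⁻¹' F (ι l)) / μ (F (ι l))).toNNReal : ℝ≥0) : ℝ≥0∞) := by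
    intro n
    simp only [h]
    rw [lintegral_tsum fun l => by
      exact ((measurable_const.indicator (hFmeas _)).comp (hφ.iterate n)).aemeasurable]
    refine tsum_congr fun l => ?_
    have hind : ∀ x, (F (ι l)).indicator (fun _ => (ε l : ℝ≥0∞) / μ (F (ι l))) (φ^[n] x) =
        (φ^[n] ⁻¹' F (ι l)).indicator (fun _ => (ε l : ℝ≥0∞) / μ (F (ι l))) x := fun x => rfl
    simp only [hind]
    rw [lintegral_indicator_const (hφ.iterate n (hFmeas _)), ENNReal.coe_mul,
      ENNReal.coe_toNNReal (hfin' _ _)]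
    simp only [div_eq_mul_inv]
    ring
  have hmod : ∀ n, ∫⁻ x, Φ (((ψ ∘ h) ∘ φ^[n]) x) ∂μ =
      ∑' l, ((ε l * (μ (φ^[n] ⁻¹' F (ι l)) / μ (F (ι l))).toNNReal : ℝ≥0) : ℝ≥0∞) := by
    intro n
    rw [← hint n]
    refine lintegral_congr_ae ?_
    filter_upwards [ae_lt_top (hh.comp (hφ.iterate n)) (by
      have := hS n
      rw [← hint n] at this
      exact this.ne)] with x hx
    exact hψ _ hx
  refine ⟨ψ ∘ h, ⟨hψm.comp hh, 1, one_pos, ?_⟩, ?_, ?_⟩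
  · have h0 := hmod 0
    simp only [Function.iterate_zero, Function.comp_id] at h0
    simp only [one_mul]
    rw [h0]
    exact hS 0
  · refine le_antisymm ?_ zero_le
    have ht : Tendsto (fun j : ℕ => ENNReal.ofReal (((2 : ℝ) ^ j)⁻¹)) atTop (𝓝 0) := by
      have := ENNReal.tendsto_ofReal (tendsto_inv_atTop_zero.comp
        (tendsto_pow_atTop_atTop_of_one_lt (one_lt_two (α := ℝ))))
      simpa using this
    refine ge_of_tendsto' ht fun j => liminf_le_of_frequently_le' ?_
    refine (hS0 ((K : ℝ≥0∞) ^ j)⁻¹ (by simp)).mono fun n hn => ?_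
    refine luxNorm_le_of_lintegral_le hY hK j ?_
    rw [hmod n]
    refine (mul_le_mul_right hn.le _).trans ?_
    exact ENNReal.mul_inv_le_one _
  · refine top_le_iff.1 ?_
    have ht : Tendsto (fun j : ℕ => ENNReal.ofReal ((2 : ℝ) ^ j)) atTop (𝓝 ⊤) :=
      ENNReal.tendsto_ofReal_atTop.comp
        (tendsto_pow_atTop_atTop_of_one_lt (one_lt_two (α := ℝ)))
    refine le_of_tendsto' ht fun j => le_limsup_of_frequently_le' ?_
    refine (hStop ((K : ℝ≥0∞) ^ j) (by finiteness)).mono fun n hn => ?_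
    exact le_luxNorm_of_lt_lintegral hY hK j (by rw [hmod n]; exact hn)
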